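/- Let V be a finite set with |V| = n, where n ≥ 4 is even, and let pos be a predicate on 3-element subsets of V. For a 2-coloring c : V → Bool, define mistakes(c) as the number of 3-element subsets E with pos(E) true on which c is not constant, plus the number of 3-element subsets E with pos(E) false on which c is constant. For each 2-element subset K ⊆ V, define the pivot coloring c_K : V → Bool by c_K(u) = true if u ∈ K or pos(K ∪ {u}) holds, and c_K(u) = false otherwise. Then there exists a 2-element subset K such that mistakes(c_K) ≤ 7 · min_{c : V → Bool} mistakes(c). -/

import Mathlib

open Classical in
/-- The number of 2-clustering mistakes for a complete unweighted 3-uniform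
MotifCC instance: the number of positive 3-element subsets on which the coloring
`c` is not constant, plus the number of negative 3-element subsets on which `c`
is constant. -/
noncomputable def mistakes {V : Type*} [Fintype V] (k : ℕ) (pos : Finset V → Prop)
    (c : V → Bool) : ℕ :=
  ((Finset.univ.powersetCard k).filter
      (fun E => pos E ∧ ¬ (∀ i ∈ E, ∀ j ∈ E, c i = c j))).card +
  ((Finset.univ.powersetCard k).filter
      (fun E => ¬ pos E ∧ (∀ i ∈ E, ∀ j ∈ E, c i = c j))).card

open Classical in
/-- The `k`-element subsets on which the coloring `c` makes a mistake. -/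
noncomputable def mistakeSet {V : Type*} [Fintype V] (k : ℕ) (pos : Finset V → Prop)
    (c : V → Bool) : Finset (Finset V) :=
  (Finset.univ.powersetCard k).filter
    (fun E => ¬ (pos E ↔ (∀ i ∈ E, ∀ j ∈ E, c i = c j)))

theorem mem_mistakeSet {V : Type*} [Fintype V] {k : ℕ} {pos : Finset V → Prop}
    {c : V → Bool} {E : Finset V} : E ∈ mistakeSet k pos c ↔
      E.card = k ∧ ¬ (pos E ↔ (∀ i ∈ E, ∀ j ∈ E, c i = c j)) := by
  simp [mistakeSet]

theorem card_mistakeSet {V : Type*} [Fintype V] (k : ℕ) (pos : Finset V → Prop)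
    (c : V → Bool) : (mistakeSet k pos c).card = mistakes k pos c := by
  classical
  unfold mistakeSet mistakes
  rw [← Finset.card_union_of_disjoint]
  · congr 1
    ext E
    simp only [Finset.mem_filter, Finset.mem_union]
    tauto
  · rw [Finset.disjoint_left]
    intro E h₁ h₂
    exact (Finset.mem_filter.1 h₂).2.1 (Finset.mem_filter.1 h₁).2.1

/-- Recoloring the vertices of `D` (up to a global color swap) changes the status of at most
`D.card * (n - 1).choose 2` triples. -/
theorem mistakes_le_add_card_mul {V : Type*} [Fintype V] (pos : Finset V → Prop)
    (c c' : V → Bool) (D : Finset V)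
    (h : ∀ u ∉ D, ∀ v ∉ D, (c' u = c' v ↔ c u = c v)) :
    mistakes 3 pos c' ≤ mistakes 3 pos c + D.card * (Fintype.card V - 1).choose 2 := by
  classical
  let T : V → Finset (Finset V) := fun u => ((Finset.univ.erase u).powersetCard 2).image (insert u)
  have hsub : mistakeSet 3 pos c' ⊆ mistakeSet 3 pos c ∪ D.biUnion T := by
    intro E hE
    rw [mem_mistakeSet] at hE
    obtain ⟨hcard, hE⟩ := hE
    by_cases hD : ∃ u ∈ E, u ∈ D
    · obtain ⟨u, huE, huD⟩ := hD
      refine Finset.mem_union_right _ (Finset.mem_biUnion.2 ⟨u, huD, ?_⟩)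
      refine Finset.mem_image.2 ⟨E.erase u, ?_, Finset.insert_erase huE⟩
      rw [Finset.mem_powersetCard, Finset.card_erase_of_mem huE, hcard]
      exact ⟨Finset.erase_subset_erase _ (Finset.subset_univ _), rfl⟩
    · push Not at hD
      refine Finset.mem_union_left _ ?_
      rw [mem_mistakeSet]
      refine ⟨hcard, ?_⟩
      have : (∀ i ∈ E, ∀ j ∈ E, c' i = c' j) ↔ (∀ i ∈ E, ∀ j ∈ E, c i = c j) :=
        forall₄_congr fun i hi j hj => h i (hD i hi) j (hD j hj)
      rwa [← this]
  have hT : ∀ u ∈ D, (T u).card ≤ (Fintype.card V - 1).choose 2 := by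
    intro u _
    refine Finset.card_image_le.trans ?_
    rw [Finset.card_powersetCard, Finset.card_erase_of_mem (Finset.mem_univ u), Finset.card_univ]
  rw [← card_mistakeSet, ← card_mistakeSet]
  calc _ ≤ _ := Finset.card_le_card hsub
    _ ≤ _ := Finset.card_union_le _ _
    _ ≤ _ := Nat.add_le_add_left (Finset.card_biUnion_le_card_mul _ _ _ hT) _

open Classical in
/-- The pairs that are monochromatic under the coloring `c`. -/
noncomputable def monoPairs {V : Type*} [Fintype V] (c : V → Bool) : Finset (Finset V) :=
  (Finset.univ.powersetCard 2).filter (fun K => ∃ b, ∀ i ∈ K, c i = b)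

theorem mem_monoPairs {V : Type*} [Fintype V] {c : V → Bool} {K : Finset V} :
    K ∈ monoPairs c ↔ K.card = 2 ∧ ∃ b, ∀ i ∈ K, c i = b := by
  simp only [monoPairs, Finset.mem_filter, Finset.mem_powersetCard, Finset.subset_univ, true_and]

theorem choose_two_le_two_mul_choose_two_add (a b : ℕ) :
    (a + b - 1).choose 2 ≤ 2 * (a.choose 2 + b.choose 2) := by
  have key : ∀ m : ℕ, m.choose 2 * 2 + m = m * m := by
    intro m
    induction m with
    | zero => rfl
    | succ k ih =>
      have : (k + 1).choose 2 = k + k.choose 2 := by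
        rw [Nat.choose_succ_succ' k 1, Nat.choose_one_right]
      rw [this]
      nlinarith
  rcases Nat.eq_zero_or_pos (a + b) with h | h
  · simp [h]
  · obtain ⟨m, hm⟩ : ∃ m, a + b = m + 1 := ⟨a + b - 1, by omega⟩
    have hm' : a + b - 1 = m := by omega
    rw [hm']
    have ka := key a
    have kb := key b
    have km := key m
    clear key hm'
    zify at *
    have hm2 : (m : ℤ) = a + b - 1 := by linarith
    nlinarith [sq_nonneg ((a : ℤ) - b)]

theorem choose_two_le_two_mul_card_monoPairs {V : Type*} [Fintype V] (c : V → Bool) :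
    (Fintype.card V - 1).choose 2 ≤ 2 * (monoPairs c).card := by
  classical
  let A : Bool → Finset V := fun b => Finset.univ.filter (fun v => c v = b)
  have hdis : Disjoint ((A true).powersetCard 2) ((A false).powersetCard 2) := by
    rw [Finset.disjoint_left]
    intro K h₁ h₂
    rw [Finset.mem_powersetCard] at h₁ h₂
    obtain ⟨x, hx⟩ : K.Nonempty := Finset.card_pos.1 (by omega)
    have e₁ := (Finset.mem_filter.1 (h₁.1 hx)).2
    have e₂ := (Finset.mem_filter.1 (h₂.1 hx)).2
    simp [e₁] at e₂
  have hsub : (A true).powersetCard 2 ∪ (A false).powersetCard 2 ⊆ monoPairs c := by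
    intro K hK
    rw [mem_monoPairs]
    simp only [Finset.mem_union, Finset.mem_powersetCard] at hK
    rcases hK with ⟨h, h2⟩ | ⟨h, h2⟩
    · exact ⟨h2, true, fun i hi => (Finset.mem_filter.1 (h hi)).2⟩
    · exact ⟨h2, false, fun i hi => (Finset.mem_filter.1 (h hi)).2⟩
  have hcard : (A true).card + (A false).card = Fintype.card V := by
    have := Finset.card_filter_add_card_filter_not (s := (Finset.univ : Finset V))
      (fun v => c v = true)
    simpa [A] using this
  have hle := Finset.card_le_card hsub
  rw [Finset.card_union_of_disjoint hdis, Finset.card_powersetCard, Finset.card_powersetCard] at hle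
  rw [← hcard]
  exact (choose_two_le_two_mul_choose_two_add _ _).trans (Nat.mul_le_mul_left 2 hle)

/-- Double counting: a triple of `F` contains at most three pairs of `M`. -/
theorem sum_card_insert_mem_le {V : Type*} [Fintype V] [DecidableEq V]
    (M F : Finset (Finset V)) (hM : ∀ K ∈ M, K.card = 2) (hF : ∀ E ∈ F, E.card = 3) :
    ∑ K ∈ M, (Finset.univ.filter (fun u => insert u K ∈ F)).card ≤ 3 * F.card := by
  calc ∑ K ∈ M, (Finset.univ.filter (fun u => insert u K ∈ F)).card
      ≤ ∑ K ∈ M, (F.filter (fun E => K ⊆ E)).card := by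
        refine Finset.sum_le_sum fun K hK => ?_
        refine Finset.card_le_card_of_injOn (fun u => insert u K) ?_ ?_
        · intro u hu
          exact Finset.mem_filter.2 ⟨(Finset.mem_filter.1 hu).2, Finset.subset_insert _ _⟩
        · intro u hu v _ huv
          have huK : u ∉ K := by
            intro hmem
            have h3 := hF _ (Finset.mem_filter.1 hu).2
            rw [Finset.insert_eq_of_mem hmem, hM K hK] at h3
            omega
          have : u ∈ insert v K := by
            rw [← (show insert u K = insert v K from huv)]
            exact Finset.mem_insert_self _ _
          exact (Finset.mem_insert.1 this).resolve_right huK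
    _ = ∑ E ∈ F, (M.filter (fun K => K ⊆ E)).card := by
        simp only [Finset.card_filter]
        exact Finset.sum_comm
    _ ≤ ∑ _E ∈ F, 3 := by
        refine Finset.sum_le_sum fun E hE => ?_
        have hsub : M.filter (fun K => K ⊆ E) ⊆ E.powersetCard 2 := by
          intro K hK
          rw [Finset.mem_filter] at hK
          exact Finset.mem_powersetCard.2 ⟨hK.2, hM K hK.1⟩
        have hle := Finset.card_le_card hsub
        rw [Finset.card_powersetCard, hF E hE] at hle
        exact hle
    _ = 3 * F.card := by rw [Finset.sum_const, smul_eq_mul, mul_comm]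

/-- The coloring obtained by pivoting on a monochromatic pair agrees with `c`, up to a color
swap, away from the vertices completing the pair to a mistake of `c`. -/
theorem pivot_eq_iff {V : Type*} [Fintype V] [DecidableEq V] {pos : Finset V → Prop}
    {c : V → Bool} {K : Finset V} (hK : K.card = 2) {b : Bool} (hb : ∀ i ∈ K, c i = b) {u : V}
    (hu : insert u K ∉ mistakeSet 3 pos c) : (u ∈ K ∨ pos (insert u K)) ↔ c u = b := by
  by_cases huK : u ∈ K
  · simp [huK, hb u huK]
  · have hconst : (∀ i ∈ insert u K, ∀ j ∈ insert u K, c i = c j) ↔ c u = b := by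
      constructor
      · intro h
        obtain ⟨x, hx⟩ : K.Nonempty := Finset.card_pos.1 (by omega)
        rw [← hb x hx]
        exact h u (Finset.mem_insert_self _ _) x (Finset.mem_insert_of_mem hx)
      · intro h
        have hall : ∀ i ∈ insert u K, c i = b := by
          intro i hi
          rcases Finset.mem_insert.1 hi with rfl | hi
          · exact h
          · exact hb i hi
        intro i hi j hj
        rw [hall i hi, hall j hj]
    rw [mem_mistakeSet, hconst] at hu
    have hcard : (insert u K).card = 3 := by rw [Finset.card_insert_of_notMem huK, hK]
    have hpos : pos (insert u K) ↔ c u = b := by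
      by_contra hne
      exact hu ⟨hcard, hne⟩
    simp [huK, hpos]

open Classical in
theorem stmt16 {V : Type*} [Fintype V] [DecidableEq V] (n : ℕ)
    (hn : Fintype.card V = n) (hn4 : 4 ≤ n) (heven : Even n)
    (pos : Finset V → Prop) :
    ∃ K : Finset V, K.card = 2 ∧
      mistakes 3 pos (fun u => if u ∈ K ∨ pos (insert u K) then true else false)
        ≤ 7 * ⨅ c : V → Bool, mistakes 3 pos c := by
  obtain ⟨c, hc⟩ : ∃ c : V → Bool, mistakes 3 pos c = ⨅ c : V → Bool, mistakes 3 pos c :=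
    Nat.sInf_mem (Set.range_nonempty _)
  rw [← hc]
  have hchoose := choose_two_le_two_mul_card_monoPairs c
  have hpos : 0 < (Fintype.card V - 1).choose 2 := Nat.choose_pos (by omega)
  have hne : (monoPairs c).Nonempty := Finset.card_pos.1 (by omega)
  have hsum := sum_card_insert_mem_le (monoPairs c) (mistakeSet 3 pos c)
    (fun K hK => (mem_monoPairs.1 hK).1) (fun E hE => (mem_mistakeSet.1 hE).1)
  obtain ⟨K, hK, hmin⟩ := Finset.exists_min_image (monoPairs c)
    (fun K => (Finset.univ.filter (fun u => insert u K ∈ mistakeSet 3 pos c)).card) hne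
  have hmul := (Finset.card_nsmul_le_sum _ _ _ hmin).trans hsum
  rw [smul_eq_mul, card_mistakeSet] at hmul
  obtain ⟨hK2, b, hb⟩ := mem_monoPairs.1 hK
  refine ⟨K, hK2, ?_⟩
  refine (mistakes_le_add_card_mul pos c _
    (Finset.univ.filter (fun u => insert u K ∈ mistakeSet 3 pos c)) ?_).trans ?_
  · intro u hu v hv
    simp only [Finset.mem_filter, Finset.mem_univ, true_and] at hu hv
    simp only [pivot_eq_iff hK2 hb hu, pivot_eq_iff hK2 hb hv]
    cases c u <;> cases c v <;> cases b <;> simp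
  · have := Nat.mul_le_mul_left
      (Finset.univ.filter (fun u => insert u K ∈ mistakeSet 3 pos c)).card hchoose
    nlinarith
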